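/- The Ehrhart δ-polynomial of the Lawrence polytope P_B has degree at most d; that is, δ_j = 0 for all j with d+1 ≤ j ≤ d+n−1. -/

import Mathlib

open scoped BigOperators Pointwise
open Polynomial

noncomputable section

namespace LawrencePaper

attribute [local instance] Classical.propDecidable

/-- The real vector associated to an integer vector. -/
def toR (d : ℕ) (v : Fin d → ℤ) : Fin d → ℝ := fun j => (v j : ℝ)

/-- The `i`-th standard basis vector of `ℝ^n`. -/
def e (n : ℕ) (i : Fin n) : Fin n → ℝ := Pi.single i 1

/-- The Lawrence polytope of the configuration `b`: the convex hull of the points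
`(b i, e i)` and `(0, e i)`. -/
def lawrencePolytope (d n : ℕ) (b : Fin n → Fin d → ℤ) : Set ((Fin d → ℝ) × (Fin n → ℝ)) :=
  convexHull ℝ
    ((Set.range fun i => (toR d (b i), e n i)) ∪
      (Set.range fun i => ((0 : Fin d → ℝ), e n i)))

/-- The number of lattice points in the `m`-th dilate of `P`. -/
def latticeCount (d n : ℕ) (P : Set ((Fin d → ℝ) × (Fin n → ℝ))) (m : ℕ) : ℕ :=
  Nat.card {z : (Fin d → ℤ) × (Fin n → ℤ) |
    (toR d z.1, fun j => (z.2 j : ℝ)) ∈ (m : ℝ) • P}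

/-- `δ` is the Ehrhart δ-polynomial of the `(d+n-1)`-dimensional polytope `P ⊆ ℝ^{d+n}`:
it has degree at most `n+d-1` and satisfies
`(1-t)^{n+d} * Σ_{m ≥ 0} f_P(m) t^m = δ(t)` as formal power series. -/
def IsDeltaPoly (d n : ℕ) (P : Set ((Fin d → ℝ) × (Fin n → ℝ))) (δ : Polynomial ℤ) : Prop :=
  δ.natDegree ≤ n + d - 1 ∧
    (1 - PowerSeries.X) ^ (n + d) *
      PowerSeries.mk (fun m => (latticeCount d n P m : ℤ)) = (δ : PowerSeries ℤ)

/-- Membership in the matroid `M_B`: the index set `F` corresponds to a linearly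
independent subset of the configuration. -/
def memMatroid (d n : ℕ) (b : Fin n → Fin d → ℤ) (F : Finset (Fin n)) : Prop :=
  LinearIndependent ℝ (fun i : F => toR d (b i.1))

/-- The linear span of the vectors indexed by `F`. -/
def spanF (d n : ℕ) (b : Fin n → Fin d → ℤ) (F : Finset (Fin n)) : Submodule ℝ (Fin d → ℝ) :=
  Submodule.span ℝ ((fun i => toR d (b i)) '' F)

/-- The dimension of an element `F` of the matroid: the dimension of its span. -/
def dimF (d n : ℕ) (b : Fin n → Fin d → ℤ) (F : Finset (Fin n)) : ℕ :=
  Module.finrank ℝ (spanF d n b F)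

/-- `BOX(F) = { Σ_{i ∈ F} α_i b_i  :  0 < α_i < 1 }`; `BOX(∅) = {0}`. -/
def box (d n : ℕ) (b : Fin n → Fin d → ℤ) (F : Finset (Fin n)) : Set (Fin d → ℝ) :=
  {x | ∃ α : Fin n → ℝ, (∀ i ∈ F, 0 < α i ∧ α i < 1) ∧ x = ∑ i ∈ F, α i • toR d (b i)}

/-- The number of lattice points in `BOX(F)`. -/
def boxCount (d n : ℕ) (b : Fin n → Fin d → ℤ) (F : Finset (Fin n)) : ℕ :=
  Nat.card {z : Fin d → ℤ | toR d z ∈ box d n b F}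

/-- Membership in the restricted matroid `M_F`: the index set `G` corresponds to a linearly
independent subset of the induced configuration `B_F` in `ℝ^d / Span F`. -/
def memMatroidRes (d n : ℕ) (b : Fin n → Fin d → ℤ) (F G : Finset (Fin n)) : Prop :=
  (∀ i ∈ G, toR d (b i) ∉ spanF d n b F) ∧
    LinearIndependent ℝ (fun i : G => (spanF d n b F).mkQ (toR d (b i.1)))

/-- The dimension of an element `G` of the restricted matroid `M_F`: the dimension of the
span of the corresponding vectors in `ℝ^d / Span F`. -/
def dimRes (d n : ℕ) (b : Fin n → Fin d → ℤ) (F G : Finset (Fin n)) : ℕ :=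
  Module.finrank ℝ (Submodule.span ℝ ((fun i => (spanF d n b F).mkQ (toR d (b i))) '' G))

/-- `f_i`: the number of elements of the restricted matroid `M_F` of dimension `i`. -/
def fRes (d n : ℕ) (b : Fin n → Fin d → ℤ) (F : Finset (Fin n)) (i : ℕ) : ℕ :=
  Nat.card {G : Finset (Fin n) | memMatroidRes d n b F G ∧ dimRes d n b F G = i}

/-- The `h`-polynomial `h_F(t) = Σ_{i=0}^{codim F} f_i t^i (1-t)^{codim F - i}` of `M_F`. -/
def hPoly (d n : ℕ) (b : Fin n → Fin d → ℤ) (F : Finset (Fin n)) : Polynomial ℤ :=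
  ∑ i ∈ Finset.range (d - dimF d n b F + 1),
    C (fRes d n b F i : ℤ) * X ^ i * (1 - X) ^ (d - dimF d n b F - i)

/-- The hyperplane `H_i = {u : ⟨u, b_i⟩ = r_i}`. -/
def hyperplane (d n : ℕ) (b : Fin n → Fin d → ℤ) (r : Fin n → ℝ) (i : Fin n) :
    Set (Fin d → ℝ) :=
  {u | ∑ j, u j * (b i j : ℝ) = r i}

/-- The arrangement `H` is simple: the intersection of any `l` of the hyperplanes is
either empty or has codimension `l`. -/
def Simple (d n : ℕ) (b : Fin n → Fin d → ℤ) (r : Fin n → ℝ) : Prop :=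
  ∀ s : Finset (Fin n), (⋂ i ∈ s, hyperplane d n b r i) = ∅ ∨
    ∀ x ∈ ⋂ i ∈ s, hyperplane d n b r i,
      Module.finrank ℝ
        (Submodule.span ℝ ((fun u => u - x) '' ⋂ i ∈ s, hyperplane d n b r i)) + s.card = d

/-- The affine subspace `A_F = ⋂_{i ∈ F} H_i`. -/
def flat (d n : ℕ) (b : Fin n → Fin d → ℤ) (r : Fin n → ℝ) (F : Finset (Fin n)) :
    Set (Fin d → ℝ) :=
  ⋂ i ∈ F, hyperplane d n b r i

/-- The cell of the restricted arrangement `H^F` containing the point `u ∈ A_F`: all points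
of `A_F` satisfying the same relations `<`, `=`, `>` as `u` with respect to each hyperplane
of `H^F`. -/
def cellOf (d n : ℕ) (b : Fin n → Fin d → ℤ) (r : Fin n → ℝ) (F : Finset (Fin n))
    (u : Fin d → ℝ) : Set (Fin d → ℝ) :=
  {v ∈ flat d n b r F | ∀ i : Fin n, toR d (b i) ∉ spanF d n b F →
    (((∑ j, v j * (b i j : ℝ)) < r i ↔ (∑ j, u j * (b i j : ℝ)) < r i) ∧
      ((∑ j, v j * (b i j : ℝ)) = r i ↔ (∑ j, u j * (b i j : ℝ)) = r i))}

/-- `f^bd_k`: the number of bounded cells of the restricted arrangement `H^F` of dimension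
`k` (the dimension of a cell being the dimension of its affine span). -/
def fBd (d n : ℕ) (b : Fin n → Fin d → ℤ) (r : Fin n → ℝ) (F : Finset (Fin n)) (k : ℕ) : ℕ :=
  Nat.card {Cs : Set (Fin d → ℝ) | (∃ u ∈ flat d n b r F, Cs = cellOf d n b r F u) ∧
    Bornology.IsBounded Cs ∧ Module.finrank ℝ (vectorSpan ℝ Cs) = k}

/-- `h^bd_F(t) = Σ_{i=0}^{codim F} f^bd_i (t-1)^i`. -/
def hBdPoly (d n : ℕ) (b : Fin n → Fin d → ℤ) (r : Fin n → ℝ) (F : Finset (Fin n)) :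
    Polynomial ℤ :=
  ∑ i ∈ Finset.range (d - dimF d n b F + 1), C (fBd d n b r F i : ℤ) * (X - 1) ^ i

/-- The complement within `A_F` of the union of the hyperplanes of `H^F`. -/
def arrComplement (d n : ℕ) (b : Fin n → Fin d → ℤ) (r : Fin n → ℝ) (F : Finset (Fin n)) :
    Set (Fin d → ℝ) :=
  flat d n b r F \ ⋃ i ∈ {i : Fin n | toR d (b i) ∉ spanF d n b F}, hyperplane d n b r i

/-- `R^bd_F`: the number of bounded regions (connected components of the complement within
`A_F` of the union of the hyperplanes) of the restricted arrangement `H^F`. -/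
def boundedRegionCount (d n : ℕ) (b : Fin n → Fin d → ℤ) (r : Fin n → ℝ)
    (F : Finset (Fin n)) : ℕ :=
  Nat.card {R : Set (Fin d → ℝ) | (∃ x ∈ arrComplement d n b r F,
    R = connectedComponentIn (arrComplement d n b r F) x) ∧ Bornology.IsBounded R}

/-- `F` is a maximal linearly independent subset of the configuration. -/
def IsMaximalIndep (d n : ℕ) (b : Fin n → Fin d → ℤ) (F : Finset (Fin n)) : Prop :=
  memMatroid d n b F ∧ ∀ G : Finset (Fin n), memMatroid d n b G → F ⊆ G → F = G

/-- The matroid `M_B` is coloop free: no element of the configuration lies in every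
maximal linearly independent subset. -/
def ColoopFree (d n : ℕ) (b : Fin n → Fin d → ℤ) : Prop :=
  ∀ i : Fin n, ∃ F : Finset (Fin n), IsMaximalIndep d n b F ∧ i ∉ F

/-- `f_i`: the number of elements of the matroid `M_B` of dimension `i`. -/
def fMat (d n : ℕ) (b : Fin n → Fin d → ℤ) (i : ℕ) : ℕ :=
  Nat.card {F : Finset (Fin n) | memMatroid d n b F ∧ dimF d n b F = i}


section Zonotope

variable {L V : Type} [AddCommGroup L] [AddCommGroup V] [Module ℝ V]

/-- The elements of `L` whose image under `φ` lies in the zonotope `∑ [0, c i] φ (b i)`. -/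
def zonotopePoints (φ : L →+ V) {n : ℕ} (b : Fin n → L) (c : Fin n → ℕ) : Set L :=
  {z | ∃ t : Fin n → ℝ, (∀ i, 0 ≤ t i ∧ t i ≤ c i) ∧ φ z = ∑ i, t i • φ (b i)}

theorem mem_diff_iff_exists_isLeast {J : Set ℝ}
    (hmin : J.Nonempty → ∃ a, IsLeast J a) (hconn : J.OrdConnected) (k : ℕ) :
    ((∃ s ∈ J, 0 ≤ s ∧ s ≤ ((k + 1 : ℕ) : ℝ)) ∧ ¬ ∃ s ∈ J, 0 ≤ s ∧ s ≤ (k : ℝ)) ↔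
      ∃ a, IsLeast J a ∧ (k : ℝ) < a ∧ a ≤ k + 1 := by
  push_cast
  have hk : (0 : ℝ) ≤ k := k.cast_nonneg
  constructor
  · rintro ⟨⟨s, hs, hs0, hs1⟩, hno⟩
    obtain ⟨a, ha⟩ := hmin ⟨s, hs⟩
    refine ⟨a, ha, ?_, (ha.2 hs).trans hs1⟩
    by_contra! hak
    rcases le_or_gt 0 a with h0 | h0
    · exact hno ⟨a, ha.1, h0, hak⟩
    · exact hno ⟨0, hconn.out ha.1 hs ⟨h0.le, hs0⟩, le_rfl, hk⟩
  · rintro ⟨a, ha, h1, h2⟩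
    refine ⟨⟨a, ha.1, by linarith, h2⟩, ?_⟩
    rintro ⟨s, hs, -, hsk⟩
    linarith [ha.2 hs]

theorem bijOn_mk_fibers {b₀ : L} {J : L → Set ℝ}
    (hshift : ∀ z (j : ℤ) s, s ∈ J (z + j • b₀) ↔ s - j ∈ J z)
    (hmin : ∀ z, (J z).Nonempty → ∃ a, IsLeast (J z) a) (hconn : ∀ z, (J z).OrdConnected)
    {M : Set (L ⧸ AddSubgroup.zmultiples b₀)}
    (hM : ∀ z : L, (z : L ⧸ AddSubgroup.zmultiples b₀) ∈ M ↔ (J z).Nonempty) (k : ℕ) :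
    Set.BijOn (fun z : L => (z : L ⧸ AddSubgroup.zmultiples b₀))
      ({z | ∃ s ∈ J z, 0 ≤ s ∧ s ≤ ((k + 1 : ℕ) : ℝ)} \ {z | ∃ s ∈ J z, 0 ≤ s ∧ s ≤ (k : ℝ)})
      M := by
  have key : ∀ z, z ∈ ({z | ∃ s ∈ J z, 0 ≤ s ∧ s ≤ ((k + 1 : ℕ) : ℝ)} \
      {z | ∃ s ∈ J z, 0 ≤ s ∧ s ≤ (k : ℝ)}) ↔ ∃ a, IsLeast (J z) a ∧ (k : ℝ) < a ∧ a ≤ k + 1 :=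
    fun z => mem_diff_iff_exists_isLeast (hmin z) (hconn z) k
  have hleast : ∀ z (j : ℤ) a, IsLeast (J z) a → IsLeast (J (z + j • b₀)) (a + j) := by
    intro z j a ha
    refine ⟨(hshift _ _ _).2 (by simpa using ha.1), fun s hs => ?_⟩
    have := ha.2 ((hshift _ _ _).1 hs)
    linarith
  refine ⟨fun z hz => ?_, fun z hz w hw hzw => ?_, fun q hq => ?_⟩
  · obtain ⟨a, ha, -⟩ := (key z).1 hz
    exact (hM z).2 ⟨a, ha.1⟩
  · obtain ⟨a, ha, ha1, ha2⟩ := (key z).1 hz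
    obtain ⟨a', ha', ha1', ha2'⟩ := (key w).1 hw
    obtain ⟨j, hj⟩ := AddSubgroup.mem_zmultiples_iff.1 (QuotientAddGroup.eq.1 hzw)
    have hw' : w = z + j • b₀ := by rw [hj]; abel
    have h := (hleast z j a ha).unique (hw' ▸ ha')
    have h1 : (j : ℝ) < 1 := by linarith
    have h2 : (-1 : ℝ) < j := by linarith
    have h3 : j < 1 := by exact_mod_cast h1
    have h4 : -1 < j := by exact_mod_cast h2
    obtain rfl : j = 0 := by omega
    simp [hw']
  · obtain ⟨z, rfl⟩ := QuotientAddGroup.mk_surjective q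
    obtain ⟨a, ha⟩ := hmin z ((hM z).1 hq)
    refine ⟨z + ((k : ℤ) - ⌈a⌉ + 1) • b₀, (key _).2 ⟨_, hleast z _ a ha, ?_, ?_⟩, ?_⟩
    · push_cast; linarith [Int.ceil_lt_add_one a]
    · push_cast; linarith [Int.le_ceil a]
    · refine QuotientAddGroup.eq.2 (AddSubgroup.mem_zmultiples_iff.2
        ⟨-((k : ℤ) - ⌈a⌉ + 1), ?_⟩)
      rw [neg_smul]; abel

theorem ncard_fibers {b₀ : L} {J : L → Set ℝ}
    (hshift : ∀ z (j : ℤ) s, s ∈ J (z + j • b₀) ↔ s - j ∈ J z)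
    (hmin : ∀ z, (J z).Nonempty → ∃ a, IsLeast (J z) a) (hconn : ∀ z, (J z).OrdConnected)
    {M : Set (L ⧸ AddSubgroup.zmultiples b₀)}
    (hM : ∀ z : L, (z : L ⧸ AddSubgroup.zmultiples b₀) ∈ M ↔ (J z).Nonempty)
    (hfin : ∀ k : ℕ, {z | ∃ s ∈ J z, 0 ≤ s ∧ s ≤ (k : ℝ)}.Finite) (k : ℕ) :
    {z | ∃ s ∈ J z, 0 ≤ s ∧ s ≤ (k : ℝ)}.ncard =
      {z | ∃ s ∈ J z, 0 ≤ s ∧ s ≤ ((0 : ℕ) : ℝ)}.ncard + k * M.ncard := by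
  induction k with
  | zero => simp
  | succ k ih =>
    have hsub : {z | ∃ s ∈ J z, 0 ≤ s ∧ s ≤ (k : ℝ)} ⊆
        {z | ∃ s ∈ J z, 0 ≤ s ∧ s ≤ ((k + 1 : ℕ) : ℝ)} := by
      rintro z ⟨s, hs, h0, h1⟩
      exact ⟨s, hs, h0, by push_cast; linarith⟩
    rw [← Set.ncard_sdiff_add_ncard_of_subset hsub (hfin _), ih,
      (bijOn_mk_fibers hshift hmin hconn hM k).ncard_eq]
    ring

theorem exists_isLeast_smul_sub_mem {W : Type*} [NormedAddCommGroup W] [NormedSpace ℝ W]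
    {Q : Set W} (hQ : IsCompact Q) {v : W} (hv : v ≠ 0) (w : W)
    (hne : {s : ℝ | w - s • v ∈ Q}.Nonempty) : ∃ a, IsLeast {s : ℝ | w - s • v ∈ Q} a := by
  have hemb : Topology.IsClosedEmbedding fun s : ℝ => w - s • v :=
    ((Homeomorph.subLeft w).isClosedEmbedding).comp (isClosedEmbedding_smul_left hv)
  exact (hemb.isCompact_preimage hQ).exists_isLeast hne

theorem exists_isLeast_fiber [FiniteDimensional ℝ V] {n : ℕ} (c : Fin n → ℕ) (u : Fin n → V)
    {v : V} (hv : v ≠ 0) (w : V)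
    (hne : {s : ℝ | ∃ t : Fin n → ℝ, (∀ i, 0 ≤ t i ∧ t i ≤ c i) ∧
      w - s • v = ∑ i, t i • u i}.Nonempty) :
    ∃ a, IsLeast {s : ℝ | ∃ t : Fin n → ℝ, (∀ i, 0 ≤ t i ∧ t i ≤ c i) ∧
      w - s • v = ∑ i, t i • u i} a := by
  let ε : V ≃ₗ[ℝ] (Fin (Module.finrank ℝ V) → ℝ) :=
    LinearEquiv.ofFinrankEq _ _ (by simp)
  let Q : Set (Fin (Module.finrank ℝ V) → ℝ) :=
    (fun t : Fin n → ℝ => ∑ i, t i • ε (u i)) '' Set.Icc 0 (fun i => (c i : ℝ))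
  have hQ : IsCompact Q := isCompact_Icc.image (by fun_prop)
  have heq : {s : ℝ | ∃ t : Fin n → ℝ, (∀ i, 0 ≤ t i ∧ t i ≤ c i) ∧
      w - s • v = ∑ i, t i • u i} = {s : ℝ | ε w - s • ε v ∈ Q} := by
    ext s
    simp only [Set.mem_ofPred_eq, Q, Set.mem_image, Set.mem_Icc, Pi.le_def, ← forall_and,
      Pi.zero_apply]
    refine exists_congr fun t => and_congr_right fun _ => ?_
    rw [← ε.injective.eq_iff]
    simp only [map_sub, map_smul, map_sum]
    exact eq_comm
  rw [heq] at hne ⊢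
  exact exists_isLeast_smul_sub_mem hQ (by simpa using hv) _ hne

theorem ordConnected_fiber {n : ℕ} (c : Fin n → ℕ) (u : Fin n → V) (v w : V) :
    {s : ℝ | ∃ t : Fin n → ℝ, (∀ i, 0 ≤ t i ∧ t i ≤ c i) ∧
      w - s • v = ∑ i, t i • u i}.OrdConnected := by
  refine Convex.ordConnected ?_
  rintro s ⟨t, ht, hs⟩ s' ⟨t', ht', hs'⟩ α β hα hβ hαβ
  refine ⟨fun i => α * t i + β * t' i, fun i => ⟨?_, ?_⟩, ?_⟩
  · have := (ht i).1
    have := (ht' i).1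
    positivity
  · calc α * t i + β * t' i ≤ α * c i + β * c i := by
          gcongr
          exacts [(ht i).2, (ht' i).2]
      _ = c i := by rw [← add_mul, hαβ, one_mul]
  · simp only [add_smul, mul_smul, Finset.sum_add_distrib, ← Finset.smul_sum, ← hs, ← hs',
      smul_eq_mul]
    have hw : w = α • w + β • w := by rw [← add_smul, hαβ, one_smul]
    nth_rewrite 1 [hw]
    simp only [smul_sub]
    abel

/-- The map induced by `φ` modulo an element `b₀` of `L`. -/
def quotientHom (φ : L →+ V) (b₀ : L) :
    L ⧸ AddSubgroup.zmultiples b₀ →+ V ⧸ Submodule.span ℝ {φ b₀} :=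
  QuotientAddGroup.lift _ ((Submodule.span ℝ {φ b₀}).mkQ.toAddMonoidHom.comp φ) (by
    rintro _ ⟨j, rfl⟩
    simp only [AddMonoidHom.mem_ker, AddMonoidHom.comp_apply, map_zsmul]
    rw [LinearMap.toAddMonoidHom_coe, Submodule.mkQ_apply,
      (Submodule.Quotient.mk_eq_zero _).2 (Submodule.mem_span_singleton_self _), smul_zero])

theorem quotientHom_mk (φ : L →+ V) (b₀ z : L) :
    quotientHom φ b₀ z = Submodule.Quotient.mk (φ z) := rfl

/-- The fiber parameters: those `s` for which `φ z - s • φ b₀` lies in the zonotope. -/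
def fiberSet (φ : L →+ V) (b₀ : L) {n : ℕ} (b : Fin n → L) (c : Fin n → ℕ) (z : L) : Set ℝ :=
  {s : ℝ | ∃ t : Fin n → ℝ, (∀ i, 0 ≤ t i ∧ t i ≤ c i) ∧ φ z - s • φ b₀ = ∑ i, t i • φ (b i)}

theorem mem_fiberSet_add_zsmul (φ : L →+ V) (b₀ : L) {n : ℕ} (b : Fin n → L) (c : Fin n → ℕ)
    (z : L) (j : ℤ) (s : ℝ) :
    s ∈ fiberSet φ b₀ b c (z + j • b₀) ↔ s - j ∈ fiberSet φ b₀ b c z := by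
  have : φ (z + j • b₀) - s • φ b₀ = φ z - (s - j) • φ b₀ := by
    rw [map_add, map_zsmul, sub_smul, Int.cast_smul_eq_zsmul]
    abel
  simp only [fiberSet, Set.mem_ofPred_eq, this]

theorem mk_mem_zonotopePoints_iff (φ : L →+ V) (b₀ : L) {n : ℕ} (b : Fin n → L)
    (c : Fin n → ℕ) (z : L) :
    (z : L ⧸ AddSubgroup.zmultiples b₀) ∈
      zonotopePoints (quotientHom φ b₀) (fun i => (b i : L ⧸ AddSubgroup.zmultiples b₀)) c ↔
      (fiberSet φ b₀ b c z).Nonempty := by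
  have hsum : ∀ t : Fin n → ℝ,
      ∑ i, t i • (Submodule.Quotient.mk (φ (b i)) : V ⧸ Submodule.span ℝ {φ b₀}) =
        Submodule.Quotient.mk (∑ i, t i • φ (b i)) := by
    intro t
    simp only [← Submodule.mkQ_apply, map_sum, map_smul]
  simp only [zonotopePoints, fiberSet, Set.mem_ofPred_eq, Set.Nonempty, quotientHom_mk, hsum,
    Submodule.Quotient.eq, Submodule.mem_span_singleton]
  constructor
  · rintro ⟨t, ht, s, hs⟩
    exact ⟨s, t, ht, by rw [hs]; abel⟩
  · rintro ⟨s, t, ht, hs⟩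
    exact ⟨t, ht, s, by rw [← hs]; abel⟩

theorem zonotopePoints_cons (φ : L →+ V) {n : ℕ} (b : Fin (n + 1) → L) (a : ℕ)
    (c : Fin n → ℕ) :
    zonotopePoints φ b (Fin.cons a c : Fin (n + 1) → ℕ) =
      {z | ∃ s ∈ fiberSet φ (b 0) (Fin.tail b) c z, 0 ≤ s ∧ s ≤ (a : ℝ)} := by
  ext z
  simp only [zonotopePoints, fiberSet, Set.mem_ofPred_eq]
  constructor
  · rintro ⟨t, ht, hz⟩
    refine ⟨t 0, ⟨Fin.tail t, fun i => ht i.succ, ?_⟩, by simpa using ht 0⟩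
    rw [hz, Fin.sum_univ_succ]
    simp [Fin.tail]
  · rintro ⟨s, ⟨t, ht, hz⟩, hs⟩
    refine ⟨Fin.cons s t, fun i => ?_, ?_⟩
    · refine Fin.cases ?_ (fun i => ?_) i
      · simpa using hs
      · simpa using ht i
    · rw [Fin.sum_univ_succ]
      simp only [Fin.cons_zero, Fin.cons_succ]
      rw [sub_eq_iff_eq_add'] at hz
      exact hz

theorem zonotopePoints_cons_zero (φ : L →+ V) {n : ℕ} (b : Fin (n + 1) → L) (c : Fin n → ℕ) :
    zonotopePoints φ b (Fin.cons 0 c : Fin (n + 1) → ℕ) = zonotopePoints φ (Fin.tail b) c := by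
  rw [zonotopePoints_cons]
  ext z
  simp only [zonotopePoints, fiberSet, Set.mem_ofPred_eq]
  constructor
  · rintro ⟨s, ⟨t, ht, hz⟩, h0, h1⟩
    obtain rfl : s = 0 := le_antisymm (by simpa using h1) h0
    exact ⟨t, ht, by simpa using hz⟩
  · rintro ⟨t, ht, hz⟩
    exact ⟨0, ⟨t, ht, by simpa using hz⟩, le_rfl, by simp⟩

theorem zonotopePoints_cons_of_eq_zero (φ : L →+ V) {n : ℕ} (b : Fin (n + 1) → L)
    (hb : φ (b 0) = 0) (a : ℕ) (c : Fin n → ℕ) :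
    zonotopePoints φ b (Fin.cons a c : Fin (n + 1) → ℕ) = zonotopePoints φ (Fin.tail b) c := by
  rw [zonotopePoints_cons]
  ext z
  simp only [zonotopePoints, fiberSet, Set.mem_ofPred_eq, hb, smul_zero, sub_zero]
  constructor
  · rintro ⟨s, h, -⟩
    exact h
  · intro h
    exact ⟨0, h, le_rfl, by positivity⟩

theorem finite_zonotopePoints_quotient [FiniteDimensional ℝ V] (φ : L →+ V) {n : ℕ}
    (b : Fin (n + 1) → L) (hb : φ (b 0) ≠ 0) (hfin : ∀ c, (zonotopePoints φ b c).Finite)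
    (c : Fin n → ℕ) :
    (zonotopePoints (quotientHom φ (b 0))
      (fun i => (Fin.tail b i : L ⧸ AddSubgroup.zmultiples (b 0))) c).Finite := by
  have h := bijOn_mk_fibers (mem_fiberSet_add_zsmul φ (b 0) (Fin.tail b) c)
    (fun z => exists_isLeast_fiber c _ hb (φ z)) (fun z => ordConnected_fiber c _ _ (φ z))
    (mk_mem_zonotopePoints_iff φ (b 0) (Fin.tail b) c) 0
  rw [← h.image_eq]
  refine Set.Finite.image _ (Set.Finite.subset ?_ Set.sdiff_subset)
  rw [← zonotopePoints_cons]
  exact hfin _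

theorem ncard_zonotopePoints_cons [FiniteDimensional ℝ V] (φ : L →+ V) {n : ℕ}
    (b : Fin (n + 1) → L) (hb : φ (b 0) ≠ 0) (hfin : ∀ c, (zonotopePoints φ b c).Finite)
    (a : ℕ) (c : Fin n → ℕ) :
    (zonotopePoints φ b (Fin.cons a c : Fin (n + 1) → ℕ)).ncard =
      (zonotopePoints φ (Fin.tail b) c).ncard +
        a * (zonotopePoints (quotientHom φ (b 0))
          (fun i => (Fin.tail b i : L ⧸ AddSubgroup.zmultiples (b 0))) c).ncard := by
  rw [← zonotopePoints_cons_zero, zonotopePoints_cons, zonotopePoints_cons]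
  exact ncard_fibers (mem_fiberSet_add_zsmul φ (b 0) (Fin.tail b) c)
    (fun z => exists_isLeast_fiber c _ hb (φ z)) (fun z => ordConnected_fiber c _ _ (φ z))
    (mk_mem_zonotopePoints_iff φ (b 0) (Fin.tail b) c)
    (fun k => by rw [← zonotopePoints_cons]; exact hfin _) a

theorem sum_antidiagonalTuple_succ {M : Type*} [AddCommMonoid M] {n : ℕ}
    (f : (Fin (n + 1) → ℕ) → M) (m : ℕ) :
    ∑ c ∈ Finset.Nat.antidiagonalTuple (n + 1) m, f c =
      ∑ p ∈ Finset.HasAntidiagonal.antidiagonal m, ∑ c ∈ Finset.Nat.antidiagonalTuple n p.2,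
        f (Fin.cons p.1 c) := by
  rw [Finset.sum_sigma']
  refine Finset.sum_bij' (fun c _ => ⟨(c 0, ∑ i : Fin n, c i.succ), Fin.tail c⟩)
    (fun x _ => Fin.cons x.1.1 x.2) ?_ ?_ ?_ ?_ ?_
  · intro c hc
    rw [Finset.Nat.mem_antidiagonalTuple, Fin.sum_univ_succ] at hc
    simp [Finset.Nat.mem_antidiagonalTuple, hc, Fin.tail]
  · rintro ⟨⟨a, k⟩, c⟩ hx
    simp only [Finset.mem_sigma, Finset.HasAntidiagonal.mem_antidiagonal, Finset.Nat.mem_antidiagonalTuple] at hx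
    simp [Finset.Nat.mem_antidiagonalTuple, Fin.sum_univ_succ, hx]
  · intro c hc
    simp
  · rintro ⟨⟨a, k⟩, c⟩ hx
    simp only [Finset.mem_sigma, Finset.HasAntidiagonal.mem_antidiagonal, Finset.Nat.mem_antidiagonalTuple] at hx
    simp [hx]
  · intro c hc
    simp

/-- The generating series of the weighted number of lattice points in the zonotopes
`∑ [0, c i] φ (b i)`, graded by `∑ c i`. -/
def zonotopeSeries (φ : L →+ V) {n : ℕ} (b : Fin n → L) : PowerSeries ℤ :=
  PowerSeries.mk fun m =>
    ∑ c ∈ Finset.Nat.antidiagonalTuple n m, ((zonotopePoints φ b c).ncard : ℤ)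

theorem zonotopeSeries_zero (φ : L →+ V) (b : Fin 0 → L) :
    zonotopeSeries φ b = PowerSeries.C ((zonotopePoints φ b ![]).ncard : ℤ) := by
  ext m
  cases m with
  | zero => simp [zonotopeSeries]
  | succ m =>
    rw [PowerSeries.coeff_C, if_neg m.succ_ne_zero]
    simp [zonotopeSeries]

theorem zonotopeSeries_succ_of_eq_zero (φ : L →+ V) {n : ℕ} (b : Fin (n + 1) → L)
    (hb : φ (b 0) = 0) :
    zonotopeSeries φ b = PowerSeries.mk 1 * zonotopeSeries φ (Fin.tail b) := by
  ext m
  simp [zonotopeSeries, sum_antidiagonalTuple_succ, PowerSeries.coeff_mul,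
    zonotopePoints_cons_of_eq_zero φ b hb]

theorem zonotopeSeries_succ [FiniteDimensional ℝ V] (φ : L →+ V) {n : ℕ} (b : Fin (n + 1) → L)
    (hb : φ (b 0) ≠ 0) (hfin : ∀ c, (zonotopePoints φ b c).Finite) :
    zonotopeSeries φ b = PowerSeries.mk 1 * zonotopeSeries φ (Fin.tail b) +
      PowerSeries.mk (fun a => (a : ℤ)) * zonotopeSeries (quotientHom φ (b 0))
        (fun i => (Fin.tail b i : L ⧸ AddSubgroup.zmultiples (b 0))) := by
  ext m
  simp [zonotopeSeries, sum_antidiagonalTuple_succ, PowerSeries.coeff_mul,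
    ncard_zonotopePoints_cons φ b hb hfin, Finset.sum_add_distrib, Finset.mul_sum]

theorem one_sub_X_sq_mul_mk_natCast :
    (1 - PowerSeries.X) ^ 2 * PowerSeries.mk (fun a => (a : ℤ)) = PowerSeries.X := by
  have h : (1 - PowerSeries.X) * PowerSeries.mk (fun a => (a : ℤ)) =
      PowerSeries.X * PowerSeries.mk 1 := by
    ext m
    cases m with
    | zero => simp [sub_mul]
    | succ m => simp [sub_mul, PowerSeries.coeff_succ_X_mul]
  rw [sq, mul_assoc, h, mul_left_comm, mul_comm (1 - PowerSeries.X),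
    PowerSeries.mk_one_mul_one_sub_eq_one, mul_one]

theorem exists_polynomial_zonotopeSeries (n : ℕ) :
    ∀ {L V : Type} [AddCommGroup L] [AddCommGroup V] [Module ℝ V] [FiniteDimensional ℝ V]
      (φ : L →+ V) (b : Fin n → L), (∀ c, (zonotopePoints φ b c).Finite) →
      ∃ p : ℤ[X], p.natDegree ≤ Module.finrank ℝ V ∧
        (1 - PowerSeries.X) ^ (n + Module.finrank ℝ V) * zonotopeSeries φ b =
          (p : PowerSeries ℤ) := by
  have hone : (1 - PowerSeries.X) * PowerSeries.mk 1 = (1 : PowerSeries ℤ) := by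
    rw [mul_comm, PowerSeries.mk_one_mul_one_sub_eq_one]
  induction n with
  | zero =>
    intro L V _ _ _ _ φ b _
    refine ⟨(1 - X) ^ Module.finrank ℝ V * C ((zonotopePoints φ b ![]).ncard : ℤ), ?_, ?_⟩
    · have : (1 - X : ℤ[X]).natDegree ≤ 1 := by compute_degree
      calc _ ≤ _ := natDegree_mul_C_le _ _
        _ ≤ _ := natDegree_pow_le_of_le _ this
        _ = _ := mul_one _
    · rw [zonotopeSeries_zero, zero_add, Polynomial.coe_mul, Polynomial.coe_pow,
        Polynomial.coe_sub, Polynomial.coe_one, Polynomial.coe_X, Polynomial.coe_C]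
  | succ n ih =>
    intro L V _ _ _ _ φ b hfin
    have hfin' : ∀ c, (zonotopePoints φ (Fin.tail b) c).Finite := fun c => by
      rw [← zonotopePoints_cons_zero]
      exact hfin _
    obtain ⟨p, hp, hpeq⟩ := ih φ (Fin.tail b) hfin'
    by_cases hb : φ (b 0) = 0
    · refine ⟨p, hp, ?_⟩
      rw [zonotopeSeries_succ_of_eq_zero φ b hb, ← hpeq]
      linear_combination (1 - PowerSeries.X) ^ (n + Module.finrank ℝ V) *
        zonotopeSeries φ (Fin.tail b) * hone
    · obtain ⟨q, hq, hqeq⟩ := ih (quotientHom φ (b 0))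
        (fun i => (Fin.tail b i : L ⧸ AddSubgroup.zmultiples (b 0)))
        (finite_zonotopePoints_quotient φ b hb hfin)
      have hrank := Submodule.finrank_quotient_add_finrank (Submodule.span ℝ {φ (b 0)})
      rw [finrank_span_singleton hb] at hrank
      refine ⟨p + X * q, ?_, ?_⟩
      · refine (natDegree_add_le _ _).trans (max_le hp ?_)
        refine natDegree_mul_le.trans ?_
        rw [natDegree_X]
        omega
      · rw [zonotopeSeries_succ φ b hb hfin, Polynomial.coe_add, Polynomial.coe_mul,
          Polynomial.coe_X, ← hpeq, ← hqeq, ← hrank]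
        linear_combination (1 - PowerSeries.X) ^ (n + Module.finrank ℝ
            (V ⧸ Submodule.span ℝ {φ (b 0)}) + 1) *
          zonotopeSeries φ (Fin.tail b) * hone +
          (1 - PowerSeries.X) ^ (n + Module.finrank ℝ (V ⧸ Submodule.span ℝ {φ (b 0)})) *
          zonotopeSeries (quotientHom φ (b 0))
            (fun i => (Fin.tail b i : L ⧸ AddSubgroup.zmultiples (b 0))) *
          one_sub_X_sq_mul_mk_natCast

end Zonotope

/-- The inclusion of `ℤ^d` into `ℝ^d` as an additive homomorphism. -/
def toRHom (d : ℕ) : (Fin d → ℤ) →+ (Fin d → ℝ) where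
  toFun := toR d
  map_zero' := by ext; simp [toR]
  map_add' x y := by ext; simp [toR]

theorem toRHom_apply (d : ℕ) (v : Fin d → ℤ) : toRHom d v = toR d v := rfl

theorem finite_zonotopePoints_toRHom {d n : ℕ} (b : Fin n → Fin d → ℤ) (c : Fin n → ℕ) :
    (zonotopePoints (toRHom d) b c).Finite := by
  refine (Set.finite_Icc (fun j => -∑ i, (c i : ℤ) * |b i j|)
    (fun j => ∑ i, (c i : ℤ) * |b i j|)).subset ?_
  rintro z ⟨t, ht, hz⟩
  have h : ∀ j, |z j| ≤ ∑ i, (c i : ℤ) * |b i j| := by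
    intro j
    have hj : (z j : ℝ) = ∑ i, t i * (b i j : ℝ) := by
      simpa [toRHom_apply, toR] using congrFun hz j
    have : |(z j : ℝ)| ≤ ∑ i, (c i : ℝ) * |(b i j : ℝ)| := by
      rw [hj]
      refine (Finset.abs_sum_le_sum_abs _ _).trans (Finset.sum_le_sum fun i _ => ?_)
      rw [abs_mul, abs_of_nonneg (ht i).1]
      exact mul_le_mul_of_nonneg_right (ht i).2 (abs_nonneg _)
    exact_mod_cast this
  exact ⟨fun j => (abs_le.1 (h j)).1, fun j => (abs_le.1 (h j)).2⟩

theorem mem_lawrencePolytope_iff {d n : ℕ} (b : Fin n → Fin d → ℤ) (x : Fin d → ℝ)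
    (y : Fin n → ℝ) :
    (x, y) ∈ lawrencePolytope d n b ↔ ∑ i, y i = 1 ∧
      ∃ t : Fin n → ℝ, (∀ i, 0 ≤ t i ∧ t i ≤ y i) ∧ x = ∑ i, t i • toR d (b i) := by
  constructor
  · intro h
    have hconv : Convex ℝ {p : (Fin d → ℝ) × (Fin n → ℝ) | ∑ i, p.2 i = 1 ∧
        ∃ t : Fin n → ℝ, (∀ i, 0 ≤ t i ∧ t i ≤ p.2 i) ∧ p.1 = ∑ i, t i • toR d (b i)} := by
      rintro ⟨x, y⟩ ⟨hy, t, ht, hx⟩ ⟨x', y'⟩ ⟨hy', t', ht', hx'⟩ α β hα hβ hαβ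
      dsimp only at hy ht hx hy' ht' hx'
      refine ⟨?_, fun i => α * t i + β * t' i, fun i => ⟨?_, ?_⟩, ?_⟩
      · simp [Finset.sum_add_distrib, ← Finset.mul_sum, hy, hy', hαβ]
      · have := (ht i).1
        have := (ht' i).1
        positivity
      · have h1 := mul_le_mul_of_nonneg_left (ht i).2 hα
        have h2 := mul_le_mul_of_nonneg_left (ht' i).2 hβ
        simpa using add_le_add h1 h2
      · simp [hx, hx', add_smul, mul_smul, Finset.sum_add_distrib, ← Finset.smul_sum]
    refine convexHull_min ?_ hconv h
    have he : ∀ i : Fin n, (0 : Fin n → ℝ) ≤ Pi.single i 1 := fun i =>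
      Pi.single_nonneg.2 zero_le_one
    rintro _ (⟨i, rfl⟩ | ⟨i, rfl⟩)
    · refine ⟨by simp [e], Pi.single i 1, fun k => ⟨?_, le_rfl⟩, ?_⟩
      · exact he i k
      · simp [Pi.single_apply]
    · refine ⟨by simp [e], 0, fun k => ⟨le_rfl, ?_⟩, by simp⟩
      exact he i k
  · rintro ⟨hy, t, ht, rfl⟩
    let w : Fin n ⊕ Fin n → ℝ := Sum.elim t (fun i => y i - t i)
    let p : Fin n ⊕ Fin n → (Fin d → ℝ) × (Fin n → ℝ) :=
      Sum.elim (fun i => (toR d (b i), e n i)) (fun i => (0, e n i))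
    have hsum : ∑ k, w k • p k = (∑ i, t i • toR d (b i), y) := by
      rw [Fintype.sum_sum_type]
      refine Prod.ext ?_ ?_
      · simp [w, p, Prod.fst_sum]
      · ext j
        simp [w, p, Prod.snd_sum, e, Pi.single_apply]
    rw [← hsum]
    refine (convex_convexHull ℝ _).sum_mem ?_ ?_ ?_
    · rintro (i | i) -
      · exact (ht i).1
      · exact sub_nonneg.2 (ht i).2
    · simp [w, Fintype.sum_sum_type, hy]
    · rintro (i | i) -
      · exact subset_convexHull ℝ _ (Or.inl ⟨i, rfl⟩)
      · exact subset_convexHull ℝ _ (Or.inr ⟨i, rfl⟩)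

theorem mem_smul_lawrencePolytope_iff {d n : ℕ} (hn : 0 < n) (b : Fin n → Fin d → ℤ) {m : ℝ}
    (hm : 0 ≤ m) (x : Fin d → ℝ) (y : Fin n → ℝ) :
    (x, y) ∈ m • lawrencePolytope d n b ↔ ∑ i, y i = m ∧
      ∃ t : Fin n → ℝ, (∀ i, 0 ≤ t i ∧ t i ≤ y i) ∧ x = ∑ i, t i • toR d (b i) := by
  rcases hm.eq_or_lt with rfl | hm
  · have hne : (lawrencePolytope d n b).Nonempty :=
      ⟨_, subset_convexHull ℝ _ (Or.inr ⟨⟨0, hn⟩, rfl⟩)⟩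
    rw [Set.zero_smul_set hne, Set.mem_zero, Prod.mk_eq_zero]
    constructor
    · rintro ⟨rfl, rfl⟩
      exact ⟨by simp, 0, by simp, by simp⟩
    · rintro ⟨hy, t, ht, rfl⟩
      have hy0 : ∀ i, y i = 0 := fun i =>
        (Finset.sum_eq_zero_iff_of_nonneg fun i _ => (ht i).1.trans (ht i).2).1 hy i
          (Finset.mem_univ i)
      have ht0 : ∀ i, t i = 0 := fun i => le_antisymm ((ht i).2.trans (hy0 i).le) (ht i).1
      exact ⟨by simp [ht0], funext hy0⟩
  · rw [Set.mem_smul_set_iff_inv_smul_mem₀ hm.ne', Prod.smul_mk, mem_lawrencePolytope_iff]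
    refine and_congr ?_ ?_
    · simp only [Pi.smul_apply, smul_eq_mul, ← Finset.mul_sum]
      rw [inv_mul_eq_one₀ hm.ne', eq_comm]
    · constructor
      · rintro ⟨t, ht, hx⟩
        refine ⟨fun i => m * t i, fun i => ⟨mul_nonneg hm.le (ht i).1, ?_⟩, ?_⟩
        · have := (ht i).2
          rw [Pi.smul_apply, smul_eq_mul, le_inv_mul_iff₀ hm] at this
          exact this
        · rw [inv_smul_eq_iff₀ hm.ne'] at hx
          simp only [hx, mul_smul, Finset.smul_sum]
      · rintro ⟨t, ht, rfl⟩
        refine ⟨fun i => m⁻¹ * t i, fun i => ⟨mul_nonneg (inv_nonneg.2 hm.le) (ht i).1, ?_⟩, ?_⟩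
        · exact mul_le_mul_of_nonneg_left (ht i).2 (inv_nonneg.2 hm.le)
        · simp only [mul_smul, Finset.smul_sum]

theorem latticeCount_lawrencePolytope {d n : ℕ} (hn : 0 < n) (b : Fin n → Fin d → ℤ) (m : ℕ) :
    latticeCount d n (lawrencePolytope d n b) m =
      ∑ c ∈ Finset.Nat.antidiagonalTuple n m, (zonotopePoints (toRHom d) b c).ncard := by
  have hfin := finite_zonotopePoints_toRHom b
  let S := (Finset.Nat.antidiagonalTuple n m).sigma fun c => (hfin c).toFinset
  let g : (Σ _ : Fin n → ℕ, Fin d → ℤ) → (Fin d → ℤ) × (Fin n → ℤ) :=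
    fun x => (x.2, fun i => (x.1 i : ℤ))
  have hg : Function.Injective g := by
    rintro ⟨c, z⟩ ⟨c', z'⟩ h
    simp only [g, Prod.mk.injEq, funext_iff, Nat.cast_inj] at h
    obtain ⟨h1, h2⟩ := h
    obtain rfl : c = c' := funext h2
    obtain rfl : z = z' := funext h1
    rfl
  have himage : {z : (Fin d → ℤ) × (Fin n → ℤ) |
      (toR d z.1, fun j => (z.2 j : ℝ)) ∈ (m : ℝ) • lawrencePolytope d n b} = g '' S := by
    ext ⟨z, y⟩
    rw [Set.mem_ofPred_eq, mem_smul_lawrencePolytope_iff hn b m.cast_nonneg]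
    simp only [Set.mem_image, S, g, Finset.mem_coe, Finset.mem_sigma, Set.Finite.mem_toFinset,
      Finset.Nat.mem_antidiagonalTuple, zonotopePoints, Set.mem_ofPred_eq, toRHom_apply]
    constructor
    · rintro ⟨hy, t, ht, hz⟩
      have hy0 : ∀ i, 0 ≤ y i := fun i => by exact_mod_cast (ht i).1.trans (ht i).2
      lift y to Fin n → ℕ using hy0
      exact ⟨⟨y, z⟩, ⟨by exact_mod_cast hy, t, by simpa using ht, hz⟩, rfl⟩
    · rintro ⟨⟨c, z'⟩, ⟨hc, t, ht, hz⟩, h⟩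
      simp only [Prod.mk.injEq] at h
      obtain ⟨rfl, rfl⟩ := h
      exact ⟨by exact_mod_cast hc, t, by simpa using ht, hz⟩
  rw [latticeCount, himage, Nat.card_coe_set_eq, Set.ncard_image_of_injective _ hg,
    Set.ncard_coe_finset, Finset.card_sigma]
  exact Finset.sum_congr rfl fun c _ => (Set.ncard_eq_toFinset_card _ (hfin c)).symm

/-- `δ_j = 0` for `d+1 ≤ j ≤ d+n-1`. -/
theorem statement3 (d n : ℕ) (hd : 0 < d) (hn : 0 < n)
    (b : Fin n → Fin d → ℤ) (hb : ∀ i, b i ≠ 0)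
    (hgen : Submodule.span ℤ (Set.range b) = ⊤)
    (δ : Polynomial ℤ) (hδ : IsDeltaPoly d n (lawrencePolytope d n b) δ) :
    ∀ j : ℕ, d + 1 ≤ j → j ≤ d + n - 1 → δ.coeff j = 0 := by
  intro j hj _
  obtain ⟨p, hp, hpeq⟩ := exists_polynomial_zonotopeSeries n (toRHom d) b
    (finite_zonotopePoints_toRHom b)
  rw [Module.finrank_fin_fun] at hp hpeq
  have hseries : PowerSeries.mk (fun m => (latticeCount d n (lawrencePolytope d n b) m : ℤ)) =
      zonotopeSeries (toRHom d) b := by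
    simp [zonotopeSeries, latticeCount_lawrencePolytope hn]
  have hδp : δ = p := by
    rw [← Polynomial.coe_inj (R := ℤ), ← hpeq, ← hδ.2, hseries]
  rw [hδp]
  exact coeff_eq_zero_of_natDegree_lt (by omega)

end LawrencePaper
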